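/- arXiv:1905.07977 — 3 statements merged into one kernel-verified Lean document; each statement's English description precedes it below -/
import Mathlib

section
/- Let a>−1 and x̂₁, x̂₂ ∈ ℝ with x̂₁ ≠ x̂₂. With B = √π Γ(a+3/2)/Γ(a+2) and the bulk kernel K_Bulk^{(s,a)} as defined in the context, lim_{s→0⁺} (sπ/(2(a+1)B)) K_Bulk^{(s,a)}(x̂₁, x̂₂) = (1/π) sin(x̂₁−x̂₂)/(x̂₁−x̂₂). -/
open MeasureTheory Filter Finset

/-- Modified Bessel function of the first kind `I_α(t)`. -/
noncomputable def BesselI (α t : ℝ) : ℝ :=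
  ∑' ℓ : ℕ, (t/2) ^ (2*(ℓ:ℝ)+α) / (Nat.factorial ℓ * Real.Gamma ((ℓ:ℝ) + α + 1))

/-- The limiting bulk kernel at weak non-Hermiticity. -/
noncomputable def KBulk (s a : ℝ) (z₁ z₂ : ℂ) : ℂ :=
  ((2 / (s * Real.pi ^ ((3:ℝ)/2) * Real.Gamma (a+1)) : ℝ) : ℂ) *
  (((1 - 4*z₁.im^2/s^2) ^ (a/2) : ℝ) : ℂ) *
  (((1 - 4*z₂.im^2/s^2) ^ (a/2) : ℝ) : ℂ) *
  ∫ c in (0:ℝ)..1,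
    (((c*s/2) ^ (a+1/2) / BesselI (a+1/2) (c*s) : ℝ) : ℂ) *
      Complex.cos ((c:ℂ) * (z₁ - starRingEnd ℂ z₂))

/-- The entire part `∑ (t/2)^(2ℓ) / (ℓ! Γ(ℓ+α+1))` of the modified Bessel function. -/
noncomputable def besselEntire (α t : ℝ) : ℝ :=
  ∑' ℓ : ℕ, (t/2) ^ (2*ℓ) / (Nat.factorial ℓ * Real.Gamma ((ℓ:ℝ) + α + 1))

theorem half_gamma_le_gamma_nat_add {α : ℝ} (hα : -1/2 < α) (ℓ : ℕ) :
    Real.Gamma (α + 1) / 2 ≤ Real.Gamma ((ℓ:ℝ) + α + 1) := by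
  have h₀ : 0 < Real.Gamma (α + 1) := Real.Gamma_pos_of_pos (by linarith)
  have hsucc : ∀ n : ℕ, Real.Gamma (((n + 1 : ℕ) : ℝ) + α + 1)
      = (n + α + 1) * Real.Gamma ((n:ℝ) + α + 1) := by
    intro n
    have hn : (0:ℝ) ≤ n := n.cast_nonneg
    rw [← Real.Gamma_add_one (by linarith)]
    push_cast
    ring_nf
  have hpos : ∀ n : ℕ, Real.Gamma (α + 1) / 2 ≤ Real.Gamma (((n + 1 : ℕ) : ℝ) + α + 1) := by
    intro n
    induction n with
    | zero =>
      rw [hsucc 0, Nat.cast_zero, zero_add]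
      nlinarith
    | succ k ih =>
      rw [hsucc (k + 1)]
      have hk : (0:ℝ) ≤ k := k.cast_nonneg
      push_cast at ih ⊢
      nlinarith
  cases ℓ with
  | zero => rw [Nat.cast_zero, zero_add]; linarith
  | succ n => exact hpos n

theorem norm_besselEntire_term_le {α : ℝ} (hα : -1/2 < α) {R t : ℝ} (ht : |t| ≤ R) (ℓ : ℕ) :
    ‖(t/2) ^ (2*ℓ) / (Nat.factorial ℓ * Real.Gamma ((ℓ:ℝ) + α + 1))‖
      ≤ (2 / Real.Gamma (α + 1)) * (((R/2) ^ 2) ^ ℓ / Nat.factorial ℓ) := by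
  have h₀ : 0 < Real.Gamma (α + 1) := Real.Gamma_pos_of_pos (by linarith)
  have h := half_gamma_le_gamma_nat_add hα ℓ
  have hf : (0:ℝ) < Nat.factorial ℓ := by positivity
  have hR : (t/2) ^ 2 ≤ (R/2) ^ 2 := by
    have := sq_le_sq' (neg_le_of_abs_le ht) (le_of_abs_le ht)
    linarith
  have hg : 0 < Real.Gamma ((ℓ:ℝ) + α + 1) := by linarith
  rw [pow_mul, Real.norm_of_nonneg (by positivity)]
  calc ((t/2) ^ 2) ^ ℓ / (Nat.factorial ℓ * Real.Gamma ((ℓ:ℝ) + α + 1))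
      ≤ ((R/2) ^ 2) ^ ℓ / (Nat.factorial ℓ * (Real.Gamma (α + 1) / 2)) := by gcongr
    _ = _ := by field_simp

theorem summable_besselEntire_bound (α R : ℝ) :
    Summable fun ℓ : ℕ => (2 / Real.Gamma (α + 1)) * (((R/2) ^ 2) ^ ℓ / Nat.factorial ℓ) :=
  (Real.summable_pow_div_factorial _).mul_left _

theorem continuous_besselEntire {α : ℝ} (hα : -1/2 < α) : Continuous (besselEntire α) := by
  rw [continuous_iff_continuousAt]
  intro t
  have hc : ContinuousOn (besselEntire α) (Metric.ball 0 (|t| + 1)) := by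
    refine continuousOn_tsum (fun ℓ => by fun_prop)
      (summable_besselEntire_bound α (|t| + 1)) fun ℓ x hx => ?_
    rw [mem_ball_zero_iff, Real.norm_eq_abs] at hx
    exact norm_besselEntire_term_le hα hx.le ℓ
  exact hc.continuousAt (Metric.isOpen_ball.mem_nhds (by simp))

theorem besselEntire_pos {α : ℝ} (hα : -1/2 < α) (t : ℝ) : 0 < besselEntire α t := by
  have hg : ∀ ℓ : ℕ, 0 < Real.Gamma ((ℓ:ℝ) + α + 1) := fun ℓ =>
    Real.Gamma_pos_of_pos (by have : (0:ℝ) ≤ ℓ := ℓ.cast_nonneg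
                              linarith)
  refine Summable.tsum_pos ?_ (fun ℓ => ?_) 0 ?_
  · exact .of_norm_bounded (summable_besselEntire_bound α |t|)
      (norm_besselEntire_term_le hα le_rfl)
  · have := hg ℓ
    rw [pow_mul]
    positivity
  · have := hg 0
    rw [mul_zero, pow_zero]
    positivity

theorem besselEntire_zero (α : ℝ) : besselEntire α 0 = (Real.Gamma (α + 1))⁻¹ := by
  rw [besselEntire, tsum_eq_single 0 fun ℓ hℓ => by simp [hℓ]]
  simp

theorem besselI_eq_rpow_mul {t : ℝ} (ht : 0 < t) (α : ℝ) :
    BesselI α t = (t/2) ^ α * besselEntire α t := by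
  rw [BesselI, besselEntire, ← tsum_mul_left]
  refine tsum_congr fun ℓ => ?_
  rw [Real.rpow_add (by positivity), show (2 * (ℓ:ℝ)) = ((2 * ℓ : ℕ) : ℝ) by push_cast; ring,
    Real.rpow_natCast]
  ring

theorem rpow_div_besselI {t : ℝ} (ht : 0 < t) (α : ℝ) :
    (t/2) ^ α / BesselI α t = (besselEntire α t)⁻¹ := by
  have : (t/2) ^ α ≠ 0 := (Real.rpow_pos_of_pos (by positivity) _).ne'
  rw [besselI_eq_rpow_mul ht, div_mul_eq_div_div, div_self this, one_div]

theorem integral_cos_ofReal_mul {x : ℝ} (hx : x ≠ 0) :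
    ∫ c in (0:ℝ)..1, Complex.cos ((c:ℂ) * x) = ((Real.sin x / x : ℝ) : ℂ) := by
  have h : ∀ c : ℝ, Complex.cos ((c:ℂ) * x) = ((Real.cos (c * x) : ℝ) : ℂ) := by
    intro c
    push_cast
    rfl
  simp_rw [h]
  rw [intervalIntegral.integral_ofReal, intervalIntegral.integral_comp_mul_right _ hx,
    integral_cos]
  simp [div_eq_inv_mul]

theorem normalisation_const {a s : ℝ} (ha : -1 < a) (hs : 0 < s) :
    (s * Real.pi / (2*(a+1) * (Real.sqrt Real.pi * Real.Gamma (a+3/2) / Real.Gamma (a+2)))) *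
      (2 / (s * Real.pi ^ ((3:ℝ)/2) * Real.Gamma (a+1)))
      = (Real.pi * Real.Gamma (a+3/2))⁻¹ := by
  have ha' : 0 < a + 1 := by linarith
  have h₁ : Real.Gamma (a+2) = (a+1) * Real.Gamma (a+1) := by
    rw [← Real.Gamma_add_one ha'.ne']
    ring_nf
  have h₂ := Real.Gamma_pos_of_pos ha'
  have h₃ : 0 < Real.Gamma (a+3/2) := Real.Gamma_pos_of_pos (by linarith)
  have hp := Real.pi_pos
  have h₄ : Real.pi ^ ((3:ℝ)/2) = Real.pi * Real.sqrt Real.pi := by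
    rw [Real.sqrt_eq_rpow, show ((3:ℝ)/2) = 1 + 1/2 by norm_num, Real.rpow_add hp, Real.rpow_one]
  have h₅ : 0 < Real.sqrt Real.pi := Real.sqrt_pos.mpr hp
  have h₆ : Real.sqrt Real.pi ^ 2 = Real.pi := Real.sq_sqrt hp.le
  rw [h₁, h₄]
  field_simp
  rw [h₆]

theorem normalised_kBulk_ofReal {a s : ℝ} (ha : -1 < a) (hs : 0 < s) (x₁ x₂ : ℝ) :
    ((s * Real.pi / (2*(a+1) * (Real.sqrt Real.pi * Real.Gamma (a+3/2) / Real.Gamma (a+2))) : ℝ) : ℂ)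
      * KBulk s a (x₁ : ℂ) (x₂ : ℂ)
      = (((Real.pi * Real.Gamma (a+3/2))⁻¹ : ℝ) : ℂ) * ∫ c in (0:ℝ)..1,
          (((besselEntire (a+1/2) (c*s))⁻¹ : ℝ) : ℂ) * Complex.cos ((c:ℂ) * ((x₁ - x₂ : ℝ) : ℂ)) := by
  rw [← normalisation_const ha hs, KBulk, Complex.ofReal_mul]
  have hint : ∫ c in (0:ℝ)..1, (((c*s/2) ^ (a+1/2) / BesselI (a+1/2) (c*s) : ℝ) : ℂ) *
        Complex.cos ((c:ℂ) * ((x₁:ℂ) - starRingEnd ℂ (x₂:ℂ)))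
      = ∫ c in (0:ℝ)..1, (((besselEntire (a+1/2) (c*s))⁻¹ : ℝ) : ℂ) *
        Complex.cos ((c:ℂ) * ((x₁ - x₂ : ℝ) : ℂ)) := by
    refine intervalIntegral.integral_congr_ae (Eventually.of_forall fun c hc => ?_)
    rw [Set.uIoc_of_le zero_le_one] at hc
    rw [rpow_div_besselI (mul_pos hc.1 hs), Complex.conj_ofReal, Complex.ofReal_sub]
  rw [hint]
  simp only [Complex.ofReal_im, ne_eq, OfNat.ofNat_ne_zero, not_false_eq_true, zero_pow, mul_zero,
    zero_div, sub_zero, Real.one_rpow, Complex.ofReal_one, mul_one, mul_assoc]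

/-- The Hermitian limit `s → 0⁺` of the normalised bulk kernel on the real line
recovers the universal sine-kernel. -/
theorem bulk_kernel_hermitian_limit (a : ℝ) (ha : -1 < a) (x₁ x₂ : ℝ) (hx : x₁ ≠ x₂) :
    Filter.Tendsto
      (fun s : ℝ =>
        ((s * Real.pi / (2*(a+1) * (Real.sqrt Real.pi * Real.Gamma (a+3/2) / Real.Gamma (a+2))) : ℝ) : ℂ) *
          KBulk s a (x₁ : ℂ) (x₂ : ℂ))
      (nhdsWithin 0 (Set.Ioi 0))
      (nhds (((Real.sin (x₁ - x₂) / (Real.pi * (x₁ - x₂)) : ℝ) : ℂ))) := by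
  have hα : -1/2 < a + 1/2 := by linarith
  have hcont : Continuous fun s : ℝ =>
      (((Real.pi * Real.Gamma (a+3/2))⁻¹ : ℝ) : ℂ) * ∫ c in (0:ℝ)..1,
        (((besselEntire (a+1/2) (c*s))⁻¹ : ℝ) : ℂ)
          * Complex.cos ((c:ℂ) * ((x₁ - x₂ : ℝ) : ℂ)) := by
    refine continuous_const.mul
      (intervalIntegral.continuous_parametric_intervalIntegral_of_continuous' ?_ 0 1)
    have hinv : Continuous fun t => (besselEntire (a+1/2) t)⁻¹ :=
      (continuous_besselEntire hα).inv₀ fun t => (besselEntire_pos hα t).ne'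
    exact (Complex.continuous_ofReal.comp (hinv.comp (by fun_prop :
      Continuous fun p : ℝ × ℝ => p.2 * p.1))).mul (by fun_prop)
  refine ((hcont.tendsto' 0 _ ?_).mono_left nhdsWithin_le_nhds).congr' ?_
  · have h : Real.Gamma (a+3/2) ≠ 0 := (Real.Gamma_pos_of_pos (by linarith)).ne'
    simp only [mul_zero, besselEntire_zero, inv_inv]
    rw [intervalIntegral.integral_const_mul, integral_cos_ofReal_mul (sub_ne_zero.mpr hx),
      ← Complex.ofReal_mul, ← Complex.ofReal_mul, show a + 1/2 + 1 = a + 3/2 by ring]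
    congr 1
    have hne := sub_ne_zero.mpr hx
    generalize Real.Gamma (a+3/2) = g at h ⊢
    field_simp
  · filter_upwards [self_mem_nhdsWithin] with s hs
    exact (normalised_kBulk_ofReal ha hs x₁ x₂).symm
end

section
/- Let a>−1 and let z̃₁ = x̃₁+iỹ₁, z̃₂ = x̃₂+iỹ₂ ∈ ℂ with ỹ₁² < 1/4 and ỹ₂² < 1/4. With the bulk kernel K_Bulk^{(s,a)} as defined in the context, lim_{s→∞} s² K_Bulk^{(s,a)}(s z̃₁, s z̃₂) = (2/(π^{3/2} Γ(a+1))) (1 − 4ỹ₁²)^{a/2} (1 − 4ỹ₂²)^{a/2} ∫₀^∞ ((t/2)^{a+1/2} / I_{a+1/2}(t)) cos(t(z̃₁ − conj(z̃₂))) dt, and the integral on the right-hand side converges absolutely. -/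
open MeasureTheory Filter Finset

namespace BesselI

/-- Ratio of the `ℓ`-th coefficient of `(t/2)^(-α) * I_α(t)` to that of `cosh t`. -/
noncomputable def coshCoeff (α : ℝ) (l : ℕ) : ℝ :=
  ((2 * l).factorial : ℝ) / (4 ^ l * l.factorial * Real.Gamma (l + α + 1))

lemma coshCoeff_pos {α : ℝ} (hα : -(1/2) < α) (l : ℕ) : 0 < coshCoeff α l := by
  have hG : 0 < Real.Gamma (l + α + 1) :=
    Real.Gamma_pos_of_pos (by have := l.cast_nonneg (α := ℝ); linarith)
  unfold coshCoeff
  positivity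

lemma coshCoeff_succ {α : ℝ} (hα : -(1/2) < α) (l : ℕ) :
    coshCoeff α (l + 1) = coshCoeff α l * ((l + 1/2) / (l + 1 + α)) := by
  have h0 : (0:ℝ) < l + α + 1 := by have := l.cast_nonneg (α := ℝ); linarith
  have hG : 0 < Real.Gamma (l + α + 1) := Real.Gamma_pos_of_pos h0
  have hG' : Real.Gamma (((l + 1 : ℕ) : ℝ) + α + 1)
      = (l + α + 1) * Real.Gamma (l + α + 1) := by
    rw [← Real.Gamma_add_one h0.ne']
    congr 1
    push_cast
    ring
  have h1 : (l:ℝ) + 1 + α ≠ 0 := by linarith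
  have h2 : (l:ℝ) + α + 1 ≠ 0 := h0.ne'
  have h3 : ((l.factorial : ℕ) : ℝ) ≠ 0 := by positivity
  unfold coshCoeff
  rw [hG', show 2 * (l + 1) = 2 * l + 1 + 1 by ring, Nat.factorial_succ, Nat.factorial_succ,
    Nat.factorial_succ]
  push_cast
  field_simp
  ring

lemma coshCoeff_le_zero {α : ℝ} (hα : -(1/2) < α) (l : ℕ) :
    coshCoeff α l ≤ coshCoeff α 0 := by
  refine antitone_nat_of_succ_le (f := coshCoeff α) (fun n => ?_) (Nat.zero_le l)
  have hn := n.cast_nonneg (α := ℝ)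
  rw [coshCoeff_succ hα]
  refine mul_le_of_le_one_right (coshCoeff_pos hα n).le ?_
  rw [div_le_one (by linarith)]
  linarith

/-- An eventually nondecreasing sequence of positive reals is bounded below by a positive
constant. -/
lemma exists_pos_forall_le {u : ℕ → ℝ} (hu : ∀ n, 0 < u n) {N : ℕ}
    (hmono : ∀ n, N ≤ n → u n ≤ u (n + 1)) : ∃ c, 0 < c ∧ ∀ n, c ≤ u n := by
  have hfin : ∀ M : ℕ, ∃ c, 0 < c ∧ ∀ n ≤ M, c ≤ u n := by
    intro M
    induction M with
    | zero => exact ⟨u 0, hu 0, fun n hn => by rw [Nat.le_zero.mp hn]⟩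
    | succ M ih =>
      obtain ⟨c, hc, h⟩ := ih
      refine ⟨min c (u (M + 1)), lt_min hc (hu _), fun n hn => ?_⟩
      rcases Nat.le_succ_iff.mp hn with h' | rfl
      · exact (min_le_left _ _).trans (h n h')
      · exact min_le_right _ _
  obtain ⟨c, hc, h⟩ := hfin N
  refine ⟨c, hc, fun n => ?_⟩
  rcases le_total n N with hn | hn
  · exact h n hn
  · exact (h N le_rfl).trans (Nat.le_induction le_rfl (fun k hk ih => ih.trans (hmono k hk)) n hn)

lemma exists_pos_mul_pow_le_coshCoeff {α : ℝ} (hα : -(1/2) < α) {q : ℝ} (hq0 : 0 < q)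
    (hq1 : q < 1) : ∃ c, 0 < c ∧ ∀ l, c * q ^ (2 * l) ≤ coshCoeff α l := by
  obtain ⟨N, hN⟩ := exists_nat_ge ((1 + α) / (1 - q ^ 2))
  have hq2 : 0 < 1 - q ^ 2 := by nlinarith
  obtain ⟨c, hc, h⟩ := exists_pos_forall_le (u := fun l => coshCoeff α l / q ^ (2 * l))
    (fun n => div_pos (coshCoeff_pos hα n) (by positivity)) (N := N) (fun n hn => by
      have hn' : (N:ℝ) ≤ n := by exact_mod_cast hn
      have h0 := n.cast_nonneg (α := ℝ)
      have hratio : q ^ 2 ≤ (n + 1/2) / (n + 1 + α) := by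
        rw [le_div_iff₀ (by linarith)]
        rw [div_le_iff₀ hq2] at hN
        nlinarith
      show _ / _ ≤ _ / _
      rw [coshCoeff_succ hα, div_le_div_iff₀ (by positivity) (by positivity),
        show q ^ (2 * (n + 1)) = q ^ 2 * q ^ (2 * n) by ring]
      have := coshCoeff_pos hα n
      calc coshCoeff α n * (q ^ 2 * q ^ (2 * n))
          ≤ coshCoeff α n * ((n + 1/2) / (n + 1 + α) * q ^ (2 * n)) := by gcongr
        _ = _ := by ring)
  refine ⟨c, hc, fun l => ?_⟩
  have := h l
  rwa [le_div_iff₀ (by positivity)] at this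

/-- The entire function `(t/2)^(-α) * I_α(t)`, as a power series. -/
noncomputable def normalized (α t : ℝ) : ℝ :=
  ∑' l : ℕ, coshCoeff α l * (t ^ (2 * l) / (2 * l).factorial)

lemma eq_rpow_mul_normalized (α : ℝ) {t : ℝ} (ht : 0 < t) :
    BesselI α t = (t/2) ^ α * normalized α t := by
  unfold BesselI normalized
  rw [← tsum_mul_left]
  refine tsum_congr fun l => ?_
  rw [Real.rpow_add (by positivity), show (2 * (l:ℝ)) = ((2 * l : ℕ) : ℝ) by push_cast; ring,
    Real.rpow_natCast, div_pow, pow_mul 2 2 l]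
  unfold coshCoeff
  have : (((2 * l).factorial : ℕ) : ℝ) ≠ 0 := by positivity
  field_simp
  norm_num

lemma summable_normalized {α : ℝ} (hα : -(1/2) < α) (t : ℝ) :
    Summable fun l : ℕ => coshCoeff α l * (t ^ (2 * l) / (2 * l).factorial) := by
  have hpow (l : ℕ) : 0 ≤ t ^ (2 * l) / ((2 * l).factorial : ℝ) :=
    div_nonneg ((even_two_mul l).pow_nonneg t) (by positivity)
  refine Summable.of_nonneg_of_le (fun l => mul_nonneg (coshCoeff_pos hα l).le (hpow l))
    (fun l => ?_) ((Real.hasSum_cosh t).summable.mul_left (coshCoeff α 0))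
  exact mul_le_mul_of_nonneg_right (coshCoeff_le_zero hα l) (hpow l)

lemma exists_exp_le_normalized {α : ℝ} (hα : -(1/2) < α) {q : ℝ} (hq0 : 0 < q) (hq1 : q < 1) :
    ∃ c, 0 < c ∧ ∀ t, c * Real.exp (q * t) ≤ normalized α t := by
  obtain ⟨c, hc, h⟩ := exists_pos_mul_pow_le_coshCoeff hα hq0 hq1
  refine ⟨c / 2, by positivity, fun t => ?_⟩
  have hle : c * Real.cosh (q * t) ≤ normalized α t := by
    refine hasSum_le (fun l => ?_) ((Real.hasSum_cosh (q * t)).mul_left c)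
      (summable_normalized hα t).hasSum
    have hpow : 0 ≤ t ^ (2 * l) / ((2 * l).factorial : ℝ) :=
      div_nonneg ((even_two_mul l).pow_nonneg t) (by positivity)
    calc c * ((q * t) ^ (2 * l) / ((2 * l).factorial : ℝ))
        = c * q ^ (2 * l) * (t ^ (2 * l) / ((2 * l).factorial : ℝ)) := by rw [mul_pow]; ring
      _ ≤ _ := mul_le_mul_of_nonneg_right (h l) hpow
  rw [Real.cosh_eq] at hle
  nlinarith [mul_pos hc (Real.exp_pos (-(q * t)))]

lemma measurable_normalized {α : ℝ} (hα : -(1/2) < α) : Measurable (normalized α) := by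
  refine measurable_of_tendsto_metrizable (f := fun n t => ∑ l ∈ range n,
    coshCoeff α l * (t ^ (2 * l) / (2 * l).factorial)) (fun n => by fun_prop) ?_
  rw [tendsto_pi_nhds]
  exact fun t => (summable_normalized hα t).hasSum.tendsto_sum_nat

end BesselI

lemma Complex.norm_cos_le_exp_abs_im (z : ℂ) : ‖Complex.cos z‖ ≤ Real.exp |z.im| := by
  rw [Complex.cos, norm_div, Complex.norm_two, div_le_iff₀ two_pos]
  refine (norm_add_le _ _).trans ?_
  rw [Complex.norm_exp, Complex.norm_exp, mul_two]
  simp only [Complex.mul_I_re, Complex.neg_re, neg_mul, neg_neg]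
  gcongr
  · exact neg_le_abs _
  · exact le_abs_self _

/-- The reciprocal of the normalized Bessel function times `cos (t w)` is integrable on the
half-line as soon as `w` lies in the open strip `|Im w| < 1`. -/
lemma integrableOn_bessel_mul_cos {α : ℝ} (hα : -(1/2) < α) {w : ℂ} (hw : |w.im| < 1) :
    IntegrableOn (fun t : ℝ => (((t/2) ^ α / BesselI α t : ℝ) : ℂ) *
      Complex.cos ((t:ℂ) * w)) (Set.Ioi (0:ℝ)) := by
  have hquot : ∀ t ∈ Set.Ioi (0:ℝ),
      (((BesselI.normalized α t)⁻¹ : ℝ) : ℂ) * Complex.cos ((t:ℂ) * w)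
        = (((t/2) ^ α / BesselI α t : ℝ) : ℂ) * Complex.cos ((t:ℂ) * w) := by
    intro t ht
    have ht' : 0 < t := ht
    have : (t/2) ^ α ≠ 0 := by positivity
    rw [BesselI.eq_rpow_mul_normalized α ht', ← div_div, div_self this, one_div]
  refine IntegrableOn.congr_fun ?_ hquot measurableSet_Ioi
  obtain ⟨q, hq, hq1⟩ := exists_between hw
  have hq0 : 0 < q := (abs_nonneg _).trans_lt hq
  obtain ⟨c, hc, h⟩ := BesselI.exists_exp_le_normalized hα hq0 hq1
  have hmeas := BesselI.measurable_normalized hα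
  refine Integrable.mono' (g := fun t => c⁻¹ * Real.exp ((|w.im| - q) * t))
    ((integrableOn_exp_mul_Ioi (by linarith) 0).const_mul _) ?_ ?_
  · exact (by fun_prop : Measurable fun t : ℝ =>
      (((BesselI.normalized α t)⁻¹ : ℝ) : ℂ) * Complex.cos ((t:ℂ) * w)).aestronglyMeasurable
  · refine (ae_restrict_iff' measurableSet_Ioi).mpr (Eventually.of_forall fun t ht => ?_)
    have ht' : 0 < t := ht
    have hpos : 0 < c * Real.exp (q * t) := by positivity
    rw [norm_mul, Complex.norm_real, Real.norm_eq_abs,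
      abs_of_pos (inv_pos.mpr (hpos.trans_le (h t)))]
    calc (BesselI.normalized α t)⁻¹ * ‖Complex.cos ((t:ℂ) * w)‖
        ≤ (c * Real.exp (q * t))⁻¹ * Real.exp |((t:ℂ) * w).im| :=
          mul_le_mul (inv_anti₀ hpos (h t)) (Complex.norm_cos_le_exp_abs_im _) (norm_nonneg _)
            (by positivity)
      _ = c⁻¹ * Real.exp ((|w.im| - q) * t) := by
          rw [Complex.im_ofReal_mul, abs_mul, abs_of_pos ht', mul_inv, ← Real.exp_neg, mul_assoc,
            ← Real.exp_add]
          congr 2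
          ring

/-- The strong non-Hermiticity limit `s → ∞` of the rescaled bulk kernel, together with
the absolute convergence of the limiting integral. -/
theorem bulk_kernel_strong_limit (a : ℝ) (ha : -1 < a)
    (z₁ z₂ : ℂ) (h₁ : z₁.im^2 < 1/4) (h₂ : z₂.im^2 < 1/4) :
    MeasureTheory.IntegrableOn
      (fun t : ℝ => (((t/2) ^ (a+1/2) / BesselI (a+1/2) t : ℝ) : ℂ) *
        Complex.cos ((t:ℂ) * (z₁ - starRingEnd ℂ z₂))) (Set.Ioi (0:ℝ)) ∧
    Filter.Tendsto
      (fun s : ℝ => ((s^2 : ℝ) : ℂ) * KBulk s a ((s:ℂ) * z₁) ((s:ℂ) * z₂))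
      Filter.atTop
      (nhds (((2/(Real.pi ^ ((3:ℝ)/2) * Real.Gamma (a+1)) : ℝ) : ℂ) *
        (((1 - 4*z₁.im^2) ^ (a/2) : ℝ) : ℂ) *
        (((1 - 4*z₂.im^2) ^ (a/2) : ℝ) : ℂ) *
        ∫ t in Set.Ioi (0:ℝ),
          (((t/2) ^ (a+1/2) / BesselI (a+1/2) t : ℝ) : ℂ) *
            Complex.cos ((t:ℂ) * (z₁ - starRingEnd ℂ z₂)))) := by
  set w : ℂ := z₁ - starRingEnd ℂ z₂ with hw
  have hwim : |w.im| < 1 := by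
    have e : w.im = z₁.im + z₂.im := by simp [hw]
    rw [e, abs_lt]
    have h₁' := abs_lt.mp (abs_lt_of_sq_lt_sq (a := z₁.im) (b := 1/2) (by linarith) (by norm_num))
    have h₂' := abs_lt.mp (abs_lt_of_sq_lt_sq (a := z₂.im) (b := 1/2) (by linarith) (by norm_num))
    constructor <;> linarith [h₁'.1, h₁'.2, h₂'.1, h₂'.2]
  have hint := integrableOn_bessel_mul_cos (α := a + 1/2) (by linarith) hwim
  refine ⟨hint, ?_⟩
  refine ((intervalIntegral_tendsto_integral_Ioi 0 hint tendsto_id).const_mul _).congr' ?_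
  filter_upwards [eventually_gt_atTop 0] with s hs
  have him (z : ℂ) : 4 * ((s:ℂ) * z).im ^ 2 / s ^ 2 = 4 * z.im ^ 2 := by
    rw [Complex.im_ofReal_mul]
    field_simp
  have hsub := intervalIntegral.smul_integral_comp_mul_right (a := 0) (b := 1) (fun t : ℝ =>
    (((t/2) ^ (a+1/2) / BesselI (a+1/2) t : ℝ) : ℂ) * Complex.cos ((t:ℂ) * w)) s
  rw [zero_mul, one_mul, Complex.real_smul] at hsub
  have harg (c : ℝ) :
      (c:ℂ) * ((s:ℂ) * z₁ - starRingEnd ℂ ((s:ℂ) * z₂)) = ((c * s : ℝ) : ℂ) * w := by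
    rw [map_mul, Complex.conj_ofReal, hw]
    push_cast
    ring
  simp only [id_eq, KBulk, him, harg]
  rw [← hsub]
  have hs' : (s:ℂ) ≠ 0 := by exact_mod_cast hs.ne'
  have hconst : ((2 / (s * Real.pi ^ ((3:ℝ)/2) * Real.Gamma (a+1)) : ℝ) : ℂ)
      = (s:ℂ)⁻¹ * ((2 / (Real.pi ^ ((3:ℝ)/2) * Real.Gamma (a+1)) : ℝ) : ℂ) := by
    rw [← Complex.ofReal_inv, ← Complex.ofReal_mul]
    congr 1
    rw [mul_assoc, ← div_div, div_right_comm, div_eq_mul_inv _ s, mul_comm]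
  rw [hconst]
  generalize (∫ c in (0:ℝ)..1, (((c*s/2) ^ (a+1/2) / BesselI (a+1/2) (c*s) : ℝ) : ℂ) *
    Complex.cos (((c * s : ℝ) : ℂ) * w)) = J
  rw [Complex.ofReal_pow]
  field_simp
end

section
/- Let a>−1 and X₁, X₂ > 0 be real. With B = √π Γ(a+3/2)/Γ(a+2) and the edge kernel K_Edge^{(s,a)} as defined in the context, lim_{s→0⁺} (sπ/(2(a+1)B)) K_Edge^{(s,a)}(X₁, X₂) = (1/4) (X₁X₂)^{−1/4} ∫₀¹ c · J_{a+1/2}(c√X₁) J_{a+1/2}(c√X₂) dc, where J_α(t) = Σ_{ℓ=0}^∞ (−1)^ℓ (t/2)^{2ℓ+α}/(ℓ! Γ(ℓ+α+1)) is the Bessel function of the first kind. -/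
open MeasureTheory Filter Finset

/-- Bessel function of the first kind `J_α(t)`. -/
noncomputable def BesselJ (α t : ℝ) : ℝ :=
  ∑' ℓ : ℕ, (-1 : ℝ)^ℓ * (t/2) ^ (2*(ℓ:ℝ)+α) / (Nat.factorial ℓ * Real.Gamma ((ℓ:ℝ) + α + 1))

/-- The entire function `G_α(c,Z)` satisfying `G_α(c,Z) = (√Z)^{-α} J_α(c√Z)` for `Z > 0`. -/
noncomputable def GBessel (α c : ℝ) (Z : ℂ) : ℂ :=
  ∑' ℓ : ℕ, ((-1 : ℂ))^ℓ * (((c/2) ^ (2*(ℓ:ℝ)+α) : ℝ) : ℂ) * Z^ℓ /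
    ((Nat.factorial ℓ : ℂ) * ((Real.Gamma ((ℓ:ℝ) + α + 1) : ℝ) : ℂ))

/-- The limiting edge kernel at weak non-Hermiticity. -/
noncomputable def KEdge (s a : ℝ) (Z₁ Z₂ : ℂ) : ℂ :=
  ((1/(4 * Real.sqrt Real.pi * Real.Gamma (a+1)) * (s/2) ^ (a-1/2) : ℝ) : ℂ) *
  (((s^2/4 + Z₁.re - (Z₁.im/s)^2) ^ (a/2) : ℝ) : ℂ) *
  (((s^2/4 + Z₂.re - (Z₂.im/s)^2) ^ (a/2) : ℝ) : ℂ) *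
  ∫ c in (0:ℝ)..1,
    ((c ^ (a+3/2) / BesselI (a+1/2) (c*s) : ℝ) : ℂ) *
      GBessel (a+1/2) c Z₁ * GBessel (a+1/2) c (starRingEnd ℂ Z₂)

/-- The entire series `∑ xˡ / (l! Γ(l + β))` common to the Bessel functions of order `β - 1`. -/
noncomputable def besselSeries (β x : ℝ) : ℝ :=
  ∑' l : ℕ, x ^ l / (Nat.factorial l * Real.Gamma ((l : ℝ) + β))

lemma exists_inv_Gamma_nat_add_le {β : ℝ} (hβ : 0 < β) :
    ∃ C : ℝ, ∀ l : ℕ, (Real.Gamma ((l : ℝ) + β))⁻¹ ≤ C := by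
  have hmono : ∀ l : ℕ, (Real.Gamma (((l + 1 : ℕ) : ℝ) + β))⁻¹ ≤ (Real.Gamma (1 + β))⁻¹ := by
    intro l
    induction l with
    | zero => simp
    | succ k ih =>
      refine le_trans ?_ ih
      have hpos : 0 < ((k + 1 : ℕ) : ℝ) + β := by positivity
      have hΓ := Real.Gamma_pos_of_pos hpos
      have hrec : Real.Gamma (((k + 1 + 1 : ℕ) : ℝ) + β) =
          (((k + 1 : ℕ) : ℝ) + β) * Real.Gamma (((k + 1 : ℕ) : ℝ) + β) := by
        rw [← Real.Gamma_add_one hpos.ne']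
        congr 1
        push_cast
        ring
      rw [hrec]
      refine inv_anti₀ hΓ (le_mul_of_one_le_left hΓ.le ?_)
      push_cast
      linarith [Nat.cast_nonneg (α := ℝ) k]
  refine ⟨max (Real.Gamma β)⁻¹ (Real.Gamma (1 + β))⁻¹, fun l => ?_⟩
  cases l with
  | zero => simp
  | succ k => exact (hmono k).trans (le_max_right _ _)

lemma norm_besselSeries_term_le {β C : ℝ} (hβ : 0 < β)
    (hC : ∀ l : ℕ, (Real.Gamma ((l : ℝ) + β))⁻¹ ≤ C) {x r : ℝ} (hx : |x| ≤ r) (l : ℕ) :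
    ‖x ^ l / (Nat.factorial l * Real.Gamma ((l : ℝ) + β))‖ ≤ C * (r ^ l / Nat.factorial l) := by
  have hΓ : 0 < Real.Gamma ((l : ℝ) + β) := Real.Gamma_pos_of_pos (by positivity)
  have hnorm : ‖x ^ l / (Nat.factorial l * Real.Gamma ((l : ℝ) + β))‖ =
      (Real.Gamma ((l : ℝ) + β))⁻¹ * (|x| ^ l / Nat.factorial l) := by
    rw [Real.norm_eq_abs, abs_div, abs_pow, abs_mul, abs_of_pos hΓ, Nat.abs_cast]
    field_simp
  rw [hnorm]
  exact mul_le_mul (hC l) (by gcongr) (by positivity) ((inv_pos.2 hΓ).le.trans (hC l))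

lemma summable_besselSeries {β : ℝ} (hβ : 0 < β) (x : ℝ) :
    Summable fun l : ℕ => x ^ l / (Nat.factorial l * Real.Gamma ((l : ℝ) + β)) := by
  obtain ⟨C, hC⟩ := exists_inv_Gamma_nat_add_le hβ
  exact Summable.of_norm_bounded ((Real.summable_pow_div_factorial |x|).mul_left C)
    (norm_besselSeries_term_le hβ hC le_rfl)

lemma continuous_besselSeries {β : ℝ} (hβ : 0 < β) : Continuous (besselSeries β) := by
  obtain ⟨C, hC⟩ := exists_inv_Gamma_nat_add_le hβ
  refine continuous_iff_continuousAt.2 fun x => ?_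
  have hon : ContinuousOn (besselSeries β) (Metric.ball 0 (|x| + 1)) := by
    refine continuousOn_tsum (fun l => by fun_prop)
      ((Real.summable_pow_div_factorial (|x| + 1)).mul_left C) fun l y hy => ?_
    refine norm_besselSeries_term_le hβ hC ?_ l
    simpa using (mem_ball_zero_iff.1 hy).le
  refine hon.continuousAt (Metric.isOpen_ball.mem_nhds ?_)
  simp

lemma besselSeries_zero (β : ℝ) : besselSeries β 0 = (Real.Gamma β)⁻¹ := by
  rw [besselSeries, tsum_eq_single 0 fun l hl => by simp [hl]]
  simp

lemma inv_Gamma_le_besselSeries {β x : ℝ} (hβ : 0 < β) (hx : 0 ≤ x) :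
    (Real.Gamma β)⁻¹ ≤ besselSeries β x := by
  have h := (summable_besselSeries hβ x).le_tsum 0 fun l _ =>
    div_nonneg (pow_nonneg hx l)
      (mul_nonneg (Nat.cast_nonneg _) (Real.Gamma_pos_of_pos (by positivity)).le)
  simpa [besselSeries] using h

lemma rpow_two_mul_natCast_add {t : ℝ} (ht : 0 < t) (α : ℝ) (l : ℕ) :
    t ^ (2 * (l : ℝ) + α) = t ^ α * (t ^ 2) ^ l := by
  rw [add_comm, Real.rpow_add ht, ← pow_mul, ← Real.rpow_natCast t (2 * l)]
  push_cast
  rfl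

lemma BesselI_eq {t : ℝ} (α : ℝ) (ht : 0 < t) :
    BesselI α t = (t / 2) ^ α * besselSeries (α + 1) ((t / 2) ^ 2) := by
  rw [BesselI, besselSeries, ← tsum_mul_left]
  refine tsum_congr fun l => ?_
  rw [rpow_two_mul_natCast_add (by positivity), add_assoc, mul_div_assoc]

lemma BesselJ_eq {t : ℝ} (α : ℝ) (ht : 0 < t) :
    BesselJ α t = (t / 2) ^ α * besselSeries (α + 1) (-(t / 2) ^ 2) := by
  rw [BesselJ, besselSeries, ← tsum_mul_left]
  refine tsum_congr fun l => ?_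
  rw [rpow_two_mul_natCast_add (by positivity), add_assoc, neg_pow ((t / 2) ^ 2)]
  ring

lemma GBessel_ofReal {c : ℝ} (α X : ℝ) (hc : 0 < c) :
    GBessel α c (X : ℂ) =
      (((c / 2) ^ α * besselSeries (α + 1) (-((c / 2) ^ 2 * X)) : ℝ) : ℂ) := by
  rw [GBessel, besselSeries, ← tsum_mul_left, Complex.ofReal_tsum]
  refine tsum_congr fun l => ?_
  rw [rpow_two_mul_natCast_add (by positivity), add_assoc, neg_pow ((c / 2) ^ 2 * X), mul_pow]
  push_cast
  ring

/-- The product `c G_{a+1/2}(c, X₁) G_{a+1/2}(c, X₂)`, written so as to be continuous in `c`. -/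
noncomputable def weightedGProd (a X₁ X₂ c : ℝ) : ℝ :=
  2 * (c / 2) ^ (2 * a + 2) * besselSeries (a + 3 / 2) (-((c / 2) ^ 2 * X₁)) *
    besselSeries (a + 3 / 2) (-((c / 2) ^ 2 * X₂))

lemma continuous_weightedGProd {a : ℝ} (ha : -1 < a) (X₁ X₂ : ℝ) :
    Continuous (weightedGProd a X₁ X₂) := by
  have hE : Continuous (besselSeries (a + 3 / 2)) := continuous_besselSeries (by linarith)
  have hp : Continuous fun c : ℝ => (c / 2) ^ (2 * a + 2) :=
    (Real.continuous_rpow_const (by linarith)).comp (by fun_prop : Continuous fun c : ℝ => c / 2)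
  exact ((continuous_const.mul hp).mul (hE.comp (by fun_prop))).mul (hE.comp (by fun_prop))

lemma mul_rpow_mul_rpow_half {c : ℝ} (a : ℝ) (hc : 0 < c) :
    c * (c / 2) ^ (a + 1 / 2) * (c / 2) ^ (a + 1 / 2) = 2 * (c / 2) ^ (2 * a + 2) := by
  have hc2 : 0 < c / 2 := by positivity
  have h : (c / 2) ^ (2 * a + 2) = c / 2 * ((c / 2) ^ (a + 1 / 2) * (c / 2) ^ (a + 1 / 2)) := by
    rw [← Real.rpow_add hc2, mul_comm (c / 2), ← Real.rpow_add_one hc2.ne']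
    congr 1
    ring
  rw [h]
  ring

lemma mul_BesselJ_mul_BesselJ {a X₁ X₂ c : ℝ} (hX₁ : 0 < X₁) (hX₂ : 0 < X₂) (hc : 0 < c) :
    c * BesselJ (a + 1 / 2) (c * √X₁) * BesselJ (a + 1 / 2) (c * √X₂) =
      √X₁ ^ (a + 1 / 2) * √X₂ ^ (a + 1 / 2) * weightedGProd a X₁ X₂ c := by
  have hJ : ∀ X : ℝ, 0 < X → BesselJ (a + 1 / 2) (c * √X) =
      (c / 2) ^ (a + 1 / 2) * √X ^ (a + 1 / 2) *
        besselSeries (a + 3 / 2) (-((c / 2) ^ 2 * X)) := by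
    intro X hX
    rw [BesselJ_eq _ (mul_pos hc (Real.sqrt_pos.2 hX)), mul_div_right_comm,
      Real.mul_rpow (by positivity) (Real.sqrt_nonneg X), mul_pow, Real.sq_sqrt hX.le]
    norm_num [add_assoc]
  rw [hJ X₁ hX₁, hJ X₂ hX₂, weightedGProd, ← mul_rpow_mul_rpow_half a hc]
  ring

lemma KEdge_integrand_eq {a c s : ℝ} (X₁ X₂ : ℝ) (hc : 0 < c) (hs : 0 < s) :
    ((c ^ (a + 3 / 2) / BesselI (a + 1 / 2) (c * s) : ℝ) : ℂ) * GBessel (a + 1 / 2) c (X₁ : ℂ) *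
        GBessel (a + 1 / 2) c (starRingEnd ℂ (X₂ : ℂ)) =
      (((s / 2) ^ (-(a + 1 / 2)) *
        (weightedGProd a X₁ X₂ c / besselSeries (a + 3 / 2) ((c * s / 2) ^ 2)) : ℝ) : ℂ) := by
  have hβ : a + 1 / 2 + 1 = a + 3 / 2 := by ring
  have hc' : c ^ (a + 3 / 2) = c * c ^ (a + 1 / 2) := by
    rw [← hβ, Real.rpow_add_one hc.ne', mul_comm]
  rw [Complex.conj_ofReal, GBessel_ofReal _ _ hc, GBessel_ofReal _ _ hc,
    BesselI_eq _ (mul_pos hc hs), hβ, hc', weightedGProd, ← mul_rpow_mul_rpow_half a hc,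
    mul_div_assoc c s 2, Real.mul_rpow hc.le (by positivity), Real.rpow_neg (by positivity),
    ← Complex.ofReal_mul, ← Complex.ofReal_mul]
  congr 1
  have h1 : c ^ (a + 1 / 2) ≠ 0 := (Real.rpow_pos_of_pos hc _).ne'
  have h2 : (s / 2) ^ (a + 1 / 2) ≠ 0 := (Real.rpow_pos_of_pos (by positivity) _).ne'
  field_simp

/-- For real positive arguments the normalised edge kernel loses its singular powers of `s`. -/
lemma normalized_KEdge_ofReal {a s : ℝ} (X₁ X₂ : ℝ) (ha : -1 < a) (hs : 0 < s) :
    ((s * Real.pi / (2*(a+1) * (Real.sqrt Real.pi * Real.Gamma (a+3/2) / Real.Gamma (a+2))) : ℝ)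
        : ℂ) * KEdge s a (X₁ : ℂ) (X₂ : ℂ) =
      ((1 / (4 * Real.Gamma (a + 3 / 2)) * (s ^ 2 / 4 + X₁) ^ (a / 2) *
        (s ^ 2 / 4 + X₂) ^ (a / 2) * ∫ c in (0 : ℝ)..1,
          weightedGProd a X₁ X₂ c / besselSeries (a + 3 / 2) ((c * s / 2) ^ 2) : ℝ) : ℂ) := by
  have hint : ∫ c in (0 : ℝ)..1,
      ((c ^ (a + 3 / 2) / BesselI (a + 1 / 2) (c * s) : ℝ) : ℂ) * GBessel (a + 1 / 2) c (X₁ : ℂ) *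
        GBessel (a + 1 / 2) c (starRingEnd ℂ (X₂ : ℂ)) =
      (((s / 2) ^ (-(a + 1 / 2)) * ∫ c in (0 : ℝ)..1,
        weightedGProd a X₁ X₂ c / besselSeries (a + 3 / 2) ((c * s / 2) ^ 2) : ℝ) : ℂ) := by
    rw [← intervalIntegral.integral_const_mul, ← intervalIntegral.integral_ofReal]
    refine intervalIntegral.integral_congr_ae (ae_of_all _ fun c hc => ?_)
    rw [Set.uIoc_of_le zero_le_one] at hc
    exact KEdge_integrand_eq X₁ X₂ hc.1 hs
  have hpow : (s / 2) ^ (a - 1 / 2) * (s / 2) ^ (-(a + 1 / 2)) = 2 / s := by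
    rw [← Real.rpow_add (by positivity), show a - 1 / 2 + -(a + 1 / 2) = -1 by ring,
      Real.rpow_neg_one, inv_div]
  have hconst : s * Real.pi / (2 * (a + 1) * (√Real.pi * Real.Gamma (a + 3 / 2) /
      Real.Gamma (a + 2))) * (1 / (4 * √Real.pi * Real.Gamma (a + 1))) * (2 / s) =
      1 / (4 * Real.Gamma (a + 3 / 2)) := by
    have h1 : Real.Gamma (a + 2) = (a + 1) * Real.Gamma (a + 1) := by
      rw [← Real.Gamma_add_one (by linarith)]
      congr 1; ring
    have h2 : Real.Gamma (a + 1) ≠ 0 := (Real.Gamma_pos_of_pos (by linarith)).ne'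
    have h3 : Real.Gamma (a + 3 / 2) ≠ 0 := (Real.Gamma_pos_of_pos (by linarith)).ne'
    have h4 : √Real.pi ≠ 0 := (Real.sqrt_pos.2 Real.pi_pos).ne'
    have h5 : a + 1 ≠ 0 := by linarith
    have h6 : √Real.pi ^ 2 = Real.pi := Real.sq_sqrt Real.pi_pos.le
    rw [h1]
    field_simp
    rw [h6]
  rw [KEdge, hint, ← hconst, ← hpow]
  simp only [Complex.ofReal_re, Complex.ofReal_im, zero_div, ne_eq, OfNat.ofNat_ne_zero,
    not_false_eq_true, zero_pow, sub_zero]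
  simp only [← Complex.ofReal_mul]
  congr 1
  ring

lemma tendsto_integral_weightedGProd_div {a : ℝ} (ha : -1 < a) (X₁ X₂ : ℝ) :
    Tendsto (fun s : ℝ => ∫ c in (0 : ℝ)..1,
        weightedGProd a X₁ X₂ c / besselSeries (a + 3 / 2) ((c * s / 2) ^ 2))
      (nhds 0) (nhds (∫ c in (0 : ℝ)..1, weightedGProd a X₁ X₂ c * Real.Gamma (a + 3 / 2))) := by
  have hβ : 0 < a + 3 / 2 := by linarith
  have hΓ := Real.Gamma_pos_of_pos hβ
  have hE := continuous_besselSeries hβ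
  have hP := continuous_weightedGProd ha X₁ X₂
  have hle : ∀ t : ℝ, (Real.Gamma (a + 3 / 2))⁻¹ ≤ besselSeries (a + 3 / 2) (t ^ 2) :=
    fun t => inv_Gamma_le_besselSeries hβ (sq_nonneg t)
  have hpos : ∀ t : ℝ, 0 < besselSeries (a + 3 / 2) (t ^ 2) :=
    fun t => (inv_pos.2 hΓ).trans_le (hle t)
  refine intervalIntegral.tendsto_integral_filter_of_dominated_convergence
    (fun c => |weightedGProd a X₁ X₂ c| * Real.Gamma (a + 3 / 2)) ?_ ?_ ?_ ?_
  · refine Eventually.of_forall fun s => Continuous.aestronglyMeasurable ?_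
    exact hP.div (hE.comp (by fun_prop)) fun c => (hpos _).ne'
  · refine Eventually.of_forall fun s => ae_of_all _ fun c _ => ?_
    rw [norm_div, Real.norm_eq_abs, Real.norm_of_nonneg (hpos _).le, div_eq_mul_inv]
    gcongr
    exact inv_le_of_inv_le₀ hΓ (hle _)
  · exact (hP.abs.mul continuous_const).intervalIntegrable _ _
  · refine ae_of_all _ fun c _ => ?_
    have hcont : Continuous fun s : ℝ =>
        weightedGProd a X₁ X₂ c / besselSeries (a + 3 / 2) ((c * s / 2) ^ 2) :=
      continuous_const.div (hE.comp (by fun_prop)) fun s => (hpos _).ne'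
    simpa [besselSeries_zero] using hcont.tendsto 0

/-- The Hermitian limit `s → 0⁺` of the normalised edge kernel recovers the universal
Bessel-kernel of the Jacobi ensemble. -/
theorem edge_kernel_hermitian_limit (a : ℝ) (ha : -1 < a) (X₁ X₂ : ℝ)
    (hX₁ : 0 < X₁) (hX₂ : 0 < X₂) :
    Filter.Tendsto
      (fun s : ℝ =>
        ((s * Real.pi / (2*(a+1) * (Real.sqrt Real.pi * Real.Gamma (a+3/2) / Real.Gamma (a+2))) : ℝ) : ℂ) *
          KEdge s a (X₁ : ℂ) (X₂ : ℂ))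
      (nhdsWithin 0 (Set.Ioi 0))
      (nhds ((((1/4) * (X₁*X₂) ^ (-(1:ℝ)/4) *
        ∫ c in (0:ℝ)..1,
          c * BesselJ (a+1/2) (c * Real.sqrt X₁) * BesselJ (a+1/2) (c * Real.sqrt X₂) : ℝ) : ℂ))) := by
  have hΓ : Real.Gamma (a + 3 / 2) ≠ 0 := (Real.Gamma_pos_of_pos (by linarith)).ne'
  have hJ : ∫ c in (0 : ℝ)..1,
      c * BesselJ (a + 1 / 2) (c * √X₁) * BesselJ (a + 1 / 2) (c * √X₂) =
      √X₁ ^ (a + 1 / 2) * √X₂ ^ (a + 1 / 2) * ∫ c in (0 : ℝ)..1, weightedGProd a X₁ X₂ c := by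
    rw [← intervalIntegral.integral_const_mul]
    refine intervalIntegral.integral_congr_ae (ae_of_all _ fun c hc => ?_)
    rw [Set.uIoc_of_le zero_le_one] at hc
    exact mul_BesselJ_mul_BesselJ hX₁ hX₂ hc.1
  have hroot : ∀ X : ℝ, 0 < X → X ^ (-(1 : ℝ) / 4) * √X ^ (a + 1 / 2) = X ^ (a / 2) := by
    intro X hX
    rw [Real.sqrt_eq_rpow, ← Real.rpow_mul hX.le, ← Real.rpow_add hX]
    congr 1; ring
  have hfac : ∀ X : ℝ, 0 < X → Tendsto (fun s : ℝ => (s ^ 2 / 4 + X) ^ (a / 2)) (nhds 0)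
      (nhds (X ^ (a / 2))) := by
    intro X hX
    have h : Tendsto (fun s : ℝ => s ^ 2 / 4 + X) (nhds 0) (nhds X) := by
      simpa using (by fun_prop : Continuous fun s : ℝ => s ^ 2 / 4 + X).tendsto 0
    exact h.rpow_const (Or.inl hX.ne')
  have hlim := ((((hfac X₁ hX₁).const_mul (1 / (4 * Real.Gamma (a + 3 / 2)))).mul
    (hfac X₂ hX₂)).mul (tendsto_integral_weightedGProd_div ha X₁ X₂)).mono_left
      (nhdsWithin_le_nhds (s := Set.Ioi 0))
  have hval : (1 / 4) * (X₁ * X₂) ^ (-(1 : ℝ) / 4) * ∫ c in (0 : ℝ)..1,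
      c * BesselJ (a + 1 / 2) (c * √X₁) * BesselJ (a + 1 / 2) (c * √X₂) =
      1 / (4 * Real.Gamma (a + 3 / 2)) * X₁ ^ (a / 2) * X₂ ^ (a / 2) *
        ∫ c in (0 : ℝ)..1, weightedGProd a X₁ X₂ c * Real.Gamma (a + 3 / 2) := by
    rw [hJ, Real.mul_rpow hX₁.le hX₂.le, ← hroot X₁ hX₁, ← hroot X₂ hX₂,
      intervalIntegral.integral_mul_const]
    generalize Real.Gamma (a + 3 / 2) = g at hΓ ⊢
    field_simp
  rw [hval]
  refine ((Complex.continuous_ofReal.tendsto _).comp hlim).congr' ?_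
  filter_upwards [self_mem_nhdsWithin] with s hs
  exact (normalized_KEdge_ofReal X₁ X₂ ha hs).symm
end
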